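/- arXiv:1211.3313 — 4 statements merged into one kernel-verified Lean document; each statement's English description precedes it below -/
import Mathlib

section
/- Deterministic induction step in the proof of the sequential rejection principle. Fix M ∈ 𝕄 and write ℱ = ℱ(M) and 𝒯 = 𝒯(M). Suppose a (deterministic) successor function 𝒩 satisfies 𝒩(ℛ) ⊆ 𝒩(𝒮) ∪ 𝒮 for every ℛ ⊆ 𝒮 ⊊ ℋ, and suppose 𝒩(ℱ) ⊆ ℱ. Then the sets ℛ_i of the sequentially rejective procedure satisfy ℛ_i ⊆ ℱ for every i ≥ 0, and consequently ℛ_∞ ⊆ ℱ; in particular, ℛ_{i+1} ∩ 𝒯 = ∅ for every i. -/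
open Set

/-- The sequentially rejective procedure based on a deterministic successor
function `N`: `ℛ₀ = ∅`, `ℛ_{i+1} = ℛ_i ∪ N(ℛ_i)`. -/
def seqRej {ι : Type*} (N : Set ι → Set ι) : ℕ → Set ι
  | 0 => ∅
  | n + 1 => seqRej N n ∪ N (seqRej N n)

/-- **Deterministic induction step of the sequential rejection principle.**
Fix `M` and write `ℱ = {i | M ∉ hyp i}` (false nulls) and `𝒯 = {i | M ∈ hyp i}`
(true nulls).  If the successor function `N` satisfies `N(ℛ) ⊆ N(𝒮) ∪ 𝒮` for every
`ℛ ⊆ 𝒮 ⊊ ℋ` and `N(ℱ) ⊆ ℱ`, then `ℛ_i ⊆ ℱ` for every `i`, hence `ℛ_∞ ⊆ ℱ`, and in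
particular `ℛ_{i+1} ∩ 𝒯 = ∅` for every `i`. -/
theorem seqRej_subset_false_of_mono
    {𝕄 : Type*} {ι : Type*}
    (hyp : ι → Set 𝕄) (hproper : ∀ i, hyp i ≠ Set.univ)
    (M : 𝕄) (F : Set ι) (hF : F = {i | M ∉ hyp i})
    (N : Set ι → Set ι)
    (hmono : ∀ R S : Set ι, R ⊆ S → S ≠ Set.univ → N R ⊆ N S ∪ S)
    (hNF : N F ⊆ F) :
    (∀ i : ℕ, seqRej N i ⊆ F) ∧ (⋃ i, seqRej N i) ⊆ F ∧
      (∀ i : ℕ, seqRej N (i + 1) ∩ {j | M ∈ hyp j} = ∅) := by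
  have h : ∀ i : ℕ, seqRej N i ⊆ F := by
    intro i
    induction i with
    | zero => exact Set.empty_subset F
    | succ n ih =>
      refine Set.union_subset ih ?_
      by_cases hS : F = Set.univ
      · exact hS ▸ Set.subset_univ _
      · exact (hmono _ F ih hS).trans (Set.union_subset hNF Set.Subset.rfl)
  refine ⟨h, Set.iUnion_subset h, fun i => ?_⟩
  subst hF
  exact Set.disjoint_iff_inter_eq_empty.mp
    (Set.disjoint_left.mpr fun _ hj hjT => h (i + 1) hj hjT)
end

section
/- Warm-start property of monotone sequential rejection. Let ℋ be finite and let 𝒩 be a (deterministic) successor function satisfying 𝒩(ℛ) ⊆ 𝒩(𝒮) ∪ 𝒮 for every ℛ ⊆ 𝒮 ⊊ ℋ. Let ℛ_∞ be the final rejected set of the sequentially rejective procedure started from ℛ₀ = ∅. Then for every starting set 𝒮₀ with 𝒮₀ ⊆ ℛ_∞, the procedure defined by the same recursion 𝒮_{i+1} = 𝒮_i ∪ 𝒩(𝒮_i) started from 𝒮₀ has the same final rejected set: ⋃_{i≥0} 𝒮_i = ℛ_∞. -/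
open Set

/-- The sequentially rejective procedure based on a deterministic successor
function `N`, started from the set `R0`: `ℛ₀ = R0`, `ℛ_{i+1} = ℛ_i ∪ N(ℛ_i)`. -/
def seqRejFrom {ι : Type*} (N : Set ι → Set ι) (R0 : Set ι) : ℕ → Set ι
  | 0 => R0
  | n + 1 => seqRejFrom N R0 n ∪ N (seqRejFrom N R0 n)

theorem seqRejFrom_monotone {ι : Type*} (N : Set ι → Set ι) (R0 : Set ι) :
    Monotone (seqRejFrom N R0) :=
  monotone_nat_of_le_succ fun _ => Set.subset_union_left

theorem seqRejFrom_add {ι : Type*} (N : Set ι → Set ι) (R0 : Set ι) (k n : ℕ) :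
    seqRejFrom N R0 (k + n) = seqRejFrom N (seqRejFrom N R0 k) n := by
  induction n with
  | zero => rfl
  | succ n ih => rw [← add_assoc, seqRejFrom, seqRejFrom, ih]

theorem seqRejFrom_subset_seqRejFrom {ι : Type*} {N : Set ι → Set ι}
    (hmono : ∀ R S : Set ι, R ⊆ S → S ≠ Set.univ → N R ⊆ N S ∪ S)
    {R0 S0 : Set ι} (h : R0 ⊆ S0) (n : ℕ) :
    seqRejFrom N R0 n ⊆ seqRejFrom N S0 n := by
  induction n with
  | zero => exact h
  | succ n ih =>
    rw [seqRejFrom, seqRejFrom]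
    by_cases hS : seqRejFrom N S0 n = Set.univ
    · simp [hS]
    · refine Set.union_subset (ih.trans Set.subset_union_left) ?_
      rw [Set.union_comm (seqRejFrom N S0 n)]
      exact hmono _ _ ih hS

/-- **Warm-start property of monotone sequential rejection.**  Let `ℋ` (here the
finite index type `ι`) be finite and let `N` satisfy the monotonicity condition
`N(ℛ) ⊆ N(𝒮) ∪ 𝒮` for all `ℛ ⊆ 𝒮 ⊊ ℋ`.  If `ℛ_∞` is the final rejected set of the
procedure started from `∅`, then for every starting set `S0 ⊆ ℛ_∞` the procedure
started from `S0` has the same final rejected set. -/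
theorem seqRej_warm_start
    {ι : Type*} [Fintype ι]
    (N : Set ι → Set ι)
    (hmono : ∀ R S : Set ι, R ⊆ S → S ≠ Set.univ → N R ⊆ N S ∪ S)
    (S0 : Set ι) (hS0 : S0 ⊆ ⋃ n, seqRejFrom N ∅ n) :
    (⋃ n, seqRejFrom N S0 n) = ⋃ n, seqRejFrom N ∅ n := by
  refine Set.Subset.antisymm (Set.iUnion_subset fun n => ?_)
    (Set.iUnion_mono (seqRejFrom_subset_seqRejFrom hmono (Set.empty_subset S0)))
  obtain ⟨k, hk⟩ : ∃ k, S0 ⊆ seqRejFrom N ∅ k := by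
    simpa using (seqRejFrom_monotone N ∅).directed_le.exists_mem_subset_of_finset_subset_biUnion
      (s := S0.toFinite.toFinset) (by simpa using hS0)
  exact (seqRejFrom_subset_seqRejFrom hmono hk n).trans
    (seqRejFrom_add N ∅ k n ▸ Set.subset_iUnion (seqRejFrom N ∅) (k + n))
end

section
/- Exact single-step control for resampling-based testing (null-invariant transformations). Let π₁, …, π_r be bijections of Ω onto itself which form a group under composition, and let {S_H}_{H∈ℋ} be measurable real-valued test statistics on Ω, where ℋ is finite. Let 0 ≤ α ≤ 1, s = r − ⌊αr⌋, and for a nonempty 𝒯 ⊆ ℋ let q_𝒯(ω) denote the s-th smallest value among the r numbers max_{J∈𝒯} S_J(π_i(ω)), i = 1, …, r. Suppose the universal null-invariance condition holds: for every M ∈ 𝕄 and every i ∈ {1,…,r}, the joint distribution under P_M of the array (S_H(π_j(ω)))_{H∈𝒯(M), 1≤j≤r} equals the joint distribution of (S_H(π_j(π_i(ω))))_{H∈𝒯(M), 1≤j≤r}. Then for every M ∈ 𝕄 with 𝒯(M) ≠ ∅, P_M(⋃_{H∈𝒯(M)} {S_H > q_{𝒯(M)}}) ≤ α. -/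
open MeasureTheory Set Classical

/-- The `s`-th smallest value (counted with multiplicity) among `x 1, …, x r`. -/
noncomputable def sortedNth {r : ℕ} (x : Fin r → ℝ) (s : ℕ) : ℝ :=
  ((List.ofFn x).insertionSort (· ≤ ·)).getD (s - 1) 0

theorem sortedNth_comp_perm {r : ℕ} (x : Fin r → ℝ) (σ : Equiv.Perm (Fin r)) (s : ℕ) :
    sortedNth (fun i => x (σ i)) s = sortedNth x s := by
  have hperm : (List.ofFn fun i => x (σ i)).Perm (List.ofFn x) := σ.ofFn_comp_perm x
  have hsorted : (List.ofFn fun i => x (σ i)).insertionSort (· ≤ ·) =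
      (List.ofFn x).insertionSort (· ≤ ·) :=
    List.Perm.eq_of_pairwise' (List.pairwise_insertionSort _ _) (List.pairwise_insertionSort _ _)
      (((List.perm_insertionSort _ _).trans hperm).trans (List.perm_insertionSort _ _).symm)
  rw [sortedNth, sortedNth, hsorted]

theorem sortedNth_of_monotone {r : ℕ} {x : Fin r → ℝ} (hx : Monotone x) (k : Fin r) :
    sortedNth x (k + 1) = x k := by
  have hsorted : (List.ofFn x).insertionSort (· ≤ ·) = List.ofFn x :=
    List.Pairwise.insertionSort_eq (List.pairwise_ofFn.2 fun _ _ h => hx h.le)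
  rw [sortedNth, hsorted]
  simp

/-- A lower set contains the `s`-th smallest of `r` values iff it contains at least `s` of them. -/
theorem sortedNth_mem_iff {r : ℕ} (x : Fin r → ℝ) {s : ℕ} (hs : 0 < s) (hsr : s ≤ r)
    {L : Set ℝ} (hL : IsLowerSet L) :
    sortedNth x s ∈ L ↔ s ≤ (Finset.univ.filter fun i => x i ∈ L).card := by
  set σ := Tuple.sort x
  have hmono : Monotone fun i => x (σ i) := Tuple.monotone_sort x
  obtain ⟨k, rfl⟩ : ∃ k : Fin r, s = k + 1 := ⟨⟨s - 1, by omega⟩, by simp; omega⟩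
  have hcard : (Finset.univ.filter fun i => x i ∈ L).card =
      (Finset.univ.filter fun i => x (σ i) ∈ L).card :=
    (Finset.card_equiv σ fun i => by simp).symm
  rw [hcard, ← sortedNth_comp_perm x σ, sortedNth_of_monotone hmono]
  constructor
  · intro h
    rw [← Fin.card_Iic]
    refine Finset.card_le_card fun i hi => ?_
    simpa using hL (hmono (Finset.mem_Iic.1 hi)) h
  · intro h
    by_contra hk
    have hsub : (Finset.univ.filter fun i => x (σ i) ∈ L) ⊆ Finset.Iio k := fun i hi => by
      rw [Finset.mem_Iio]
      by_contra! hki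
      exact hk (hL (hmono hki) (by simpa using hi))
    have := Finset.card_le_card hsub
    rw [Fin.card_Iio] at this
    omega

theorem card_sortedNth_lt_le {r : ℕ} (x : Fin r → ℝ) {s : ℕ} (hs : 0 < s) (hsr : s ≤ r) :
    (Finset.univ.filter fun i => sortedNth x s < x i).card ≤ r - s := by
  have h := (sortedNth_mem_iff x hs hsr (isLowerSet_Iic (sortedNth x s))).1 self_mem_Iic
  have hsplit := Finset.card_filter_add_card_filter_not (s := (Finset.univ : Finset (Fin r)))
    (fun i => x i ∈ Iic (sortedNth x s))
  simp only [mem_Iic, not_le, Finset.card_univ, Fintype.card_fin] at h hsplit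
  omega

theorem measurable_sortedNth {r s : ℕ} (hs : 0 < s) (hsr : s ≤ r) :
    Measurable fun x : Fin r → ℝ => sortedNth x s := by
  refine measurable_of_Iic fun c => ?_
  have hset : (fun x : Fin r → ℝ => sortedNth x s) ⁻¹' Iic c =
      {x | s ≤ ∑ i, if x i ≤ c then 1 else 0} := by
    ext x
    rw [mem_preimage, sortedNth_mem_iff x hs hsr (isLowerSet_Iic c), Finset.card_filter]
    rfl
  rw [hset]
  refine measurableSet_le measurable_const (Finset.measurable_sum _ fun i _ => ?_)
  exact Measurable.ite (measurableSet_le (measurable_pi_apply i) measurable_const)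
    measurable_const measurable_const

/-- If at most `m` of the events `A i` can occur at once and all have probability `p`, then
`r * p ≤ m`. -/
theorem card_mul_le_of_card_mem_le {Ω : Type*} [MeasurableSpace Ω] (μ : Measure Ω)
    [IsProbabilityMeasure μ] {r m : ℕ} {A : Fin r → Set Ω} (hA : ∀ i, MeasurableSet (A i))
    (hm : ∀ ω, (Finset.univ.filter fun i => ω ∈ A i).card ≤ m) {p : ENNReal}
    (hp : ∀ i, μ (A i) = p) : r * p ≤ m := by
  calc r * p = ∑ i, μ (A i) := by simp [hp]
    _ = ∫⁻ ω, ∑ i, (A i).indicator 1 ω ∂μ := by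
      rw [lintegral_finsetSum _ fun i _ => measurable_one.indicator (hA i)]
      simp [lintegral_indicator_one (hA _)]
    _ ≤ ∫⁻ _, m ∂μ := by
      refine lintegral_mono fun ω => ?_
      simp only [indicator_apply, Pi.one_apply, Finset.sum_boole]
      exact_mod_cast hm ω
    _ = m := by simp

/-- **Exact single-step control for resampling-based testing with null-invariant
transformations.**  Hypotheses are indexed by the finite type `ι` (`hyp i ⊆ 𝕄`);
`𝒯(M) = {j | M ∈ hyp j}`.  The `π i` are measurable bijections of `Ω` with
measurable inverses which form a group under composition, `S j` are measurable
test statistics, `s = r - ⌊αr⌋`, and `q_𝒯(ω)` is the `s`-th smallest of the `r`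
values `max_{j ∈ 𝒯} S j (π i ω)`.  Under the universal null-invariance condition,
for every `M` with `𝒯(M) ≠ ∅` one has `P_M(⋃_{j ∈ 𝒯(M)} {S j > q_{𝒯(M)}}) ≤ α`. -/
theorem resampling_single_step_control
    {Ω : Type*} [MeasurableSpace Ω] {𝕄 : Type*} {ι : Type*} [Fintype ι]
    (P : 𝕄 → Measure Ω) (hP : ∀ M, IsProbabilityMeasure (P M))
    (hyp : ι → Set 𝕄) (hproper : ∀ i, hyp i ≠ Set.univ)
    (α : ℝ) (hα0 : 0 ≤ α) (hα1 : α ≤ 1)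
    (r : ℕ) (hr : 0 < r)
    (π : Fin r → Ω ≃ᵐ Ω)
    (hπinj : Function.Injective fun i => (π i : Ω → Ω))
    (hπcomp : ∀ i j : Fin r, ∃ k : Fin r, ∀ ω, π i (π j ω) = π k ω)
    (hπinv : ∀ i : Fin r, ∃ j : Fin r, ∀ ω, π i (π j ω) = ω)
    (S : ι → Ω → ℝ) (hS : ∀ i, Measurable (S i))
    (s : ℕ) (hs : s = r - Nat.floor (α * r))
    (hinvariance : ∀ (M : 𝕄) (i : Fin r),
      Measure.map
        (fun ω => fun q : {j : ι // M ∈ hyp j} × Fin r => S q.1 (π q.2 ω)) (P M) =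
      Measure.map
        (fun ω => fun q : {j : ι // M ∈ hyp j} × Fin r => S q.1 (π q.2 (π i ω)))
        (P M)) :
    ∀ (M : 𝕄) (hT : (Finset.univ.filter fun j : ι => M ∈ hyp j).Nonempty),
      P M {ω | ∃ j : ι, M ∈ hyp j ∧
        sortedNth
          (fun i : Fin r =>
            (Finset.univ.filter fun j' : ι => M ∈ hyp j').sup' hT
              (fun j' => S j' (π i ω))) s
        < S j ω} ≤ ENNReal.ofReal α := by
  intro M hT
  have := hP M
  rcases hα1.eq_or_lt with rfl | hα1
  · simpa using prob_le_one
  have hfloor : Nat.floor (α * r) < r := by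
    rw [Nat.floor_lt (by positivity)]
    have : (0 : ℝ) < r := by exact_mod_cast hr
    nlinarith
  have hs0 : 0 < s := by omega
  have hsr : s ≤ r := by omega
  obtain ⟨e, he⟩ : ∃ e, ∀ ω, π e ω = ω := by
    obtain ⟨j, hj⟩ := hπinv ⟨0, hr⟩
    obtain ⟨k, hk⟩ := hπcomp ⟨0, hr⟩ j
    exact ⟨k, fun ω => (hk ω).symm.trans (hj ω)⟩
  set t := Finset.univ.filter fun j : ι => M ∈ hyp j with ht
  let T : Ω → ℝ := fun ω => t.sup' hT fun j => S j ω
  have hmem : ∀ j ∈ t, M ∈ hyp j := fun j hj => by simpa [ht] using hj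
  have hne : t.attach.Nonempty := Finset.attach_nonempty_iff.2 hT
  -- The maximal statistics of the transformed data, read off the array of statistics.
  let F : ({j : ι // M ∈ hyp j} × Fin r → ℝ) → Fin r → ℝ :=
    fun x i => t.attach.sup' hne fun j => x (⟨j, hmem j j.2⟩, i)
  have hF : ∀ ω, F (fun q => S q.1 (π q.2 ω)) = fun i => T (π i ω) := fun ω => by
    funext i
    refine le_antisymm (Finset.sup'_le _ _ fun j _ => ?_) (Finset.sup'_le _ _ fun j hj => ?_)
    · exact Finset.le_sup' (fun j => S j (π i ω)) j.2
    · exact Finset.le_sup' (fun j : t => S j (π i ω)) (Finset.mem_attach t ⟨j, hj⟩)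
  have hFmeas : Measurable F := by
    refine measurable_pi_lambda _ fun i => ?_
    have := Finset.measurable_sup' hne (f := fun (j : t)
      (x : {j : ι // M ∈ hyp j} × Fin r → ℝ) => x (⟨j, hmem j j.2⟩, i))
      fun j _ => measurable_pi_apply _
    convert this using 1
    ext x
    simp [F, Finset.sup'_apply]
  let B : Set ({j : ι // M ∈ hyp j} × Fin r → ℝ) := {x | sortedNth (F x) s < F x e}
  have hB : MeasurableSet B := measurableSet_lt ((measurable_sortedNth hs0 hsr).comp hFmeas)
    ((measurable_pi_apply e).comp hFmeas)
  have hX : ∀ l, Measurable fun ω =>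
      fun q : {j : ι // M ∈ hyp j} × Fin r => S q.1 (π q.2 (π l ω)) := fun l =>
    measurable_pi_lambda _ fun q => (hS _).comp ((π q.2).measurable.comp (π l).measurable)
  let A : Fin r → Set Ω := fun l => {ω | sortedNth (fun i => T (π i ω)) s < T (π l ω)}
  have hA_eq : ∀ l, A l =
      (fun ω => fun q : {j : ι // M ∈ hyp j} × Fin r => S q.1 (π q.2 (π l ω))) ⁻¹' B := by
    intro l
    choose c hc using fun i => hπcomp i l
    have hcinj : Function.Injective c := fun i i' h => hπinj <| funext fun ω => by
      have h1 := hc i ((π l).symm ω)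
      have h2 := hc i' ((π l).symm ω)
      rw [MeasurableEquiv.apply_symm_apply] at h1 h2
      exact (h1.trans (by rw [h])).trans h2.symm
    let σ := Equiv.ofBijective c (Finite.injective_iff_bijective.1 hcinj)
    ext ω
    have hsort : sortedNth (fun i => T (π i (π l ω))) s = sortedNth (fun i => T (π i ω)) s := by
      simp only [hc]
      exact sortedNth_comp_perm (fun i => T (π i ω)) σ s
    rw [mem_preimage, mem_ofPred_eq, mem_ofPred_eq, hF (π l ω), hsort]
    simp only [he]
  have hA : ∀ l, MeasurableSet (A l) := fun l => by
    rw [hA_eq l]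
    exact hX l hB
  have hPA : ∀ l, P M (A l) = P M (A e) := fun l => by
    rw [hA_eq l, hA_eq e, ← Measure.map_apply (hX l) hB, ← Measure.map_apply (hX e) hB,
      ← hinvariance M l, ← hinvariance M e]
  have hevent : {ω | ∃ j : ι, M ∈ hyp j ∧ sortedNth (fun i => T (π i ω)) s < S j ω} = A e := by
    ext ω
    simp [A, T, he, Finset.lt_sup'_iff, ht]
  have hcount : r * P M (A e) ≤ (r - s : ℕ) := card_mul_le_of_card_mem_le (P M) hA
    (fun ω => card_sortedNth_lt_le (fun i => T (π i ω)) hs0 hsr) hPA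
  have hle : ((r - s : ℕ) : ENNReal) ≤ r * ENNReal.ofReal α := by
    rw [← ENNReal.ofReal_natCast, ← ENNReal.ofReal_natCast r,
      ← ENNReal.ofReal_mul (Nat.cast_nonneg r), mul_comm]
    refine ENNReal.ofReal_le_ofReal ?_
    rw [show r - s = Nat.floor (α * r) by omega]
    exact Nat.floor_le (by positivity)
  change P M {ω | ∃ j : ι, M ∈ hyp j ∧ sortedNth (fun i => T (π i ω)) s < S j ω} ≤ _
  rw [hevent]
  exact (ENNReal.mul_le_mul_iff_right (by exact_mod_cast hr.ne') (ENNReal.natCast_ne_top r)).1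
    (hcount.trans hle)
end

section
/- Monotonicity of the step-up successor function. Let ℋ be finite with p-values {p_H}_{H∈ℋ}, and for each ℛ ⊊ ℋ let α₁(ℛ) ≥ … ≥ α_{|ℋ\ℛ|}(ℛ) be ordered critical values in [0,1] satisfying: whenever ℛ ⊆ 𝒮 ⊊ ℋ, α_i(𝒮) ≥ α_i(ℛ) for every i = 1, …, |ℋ\𝒮|. Define 𝒩(ℛ) = ⋃{𝒦 ⊆ ℋ \ ℛ : p_H ≤ α_{|ℋ\(ℛ∪𝒦)|+1}(ℛ) for every H ∈ 𝒦}. Then for every ℛ ⊆ 𝒮 ⊊ ℋ one has 𝒩(ℛ) ⊆ 𝒩(𝒮) ∪ 𝒮 (pointwise, for every outcome ω). -/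
open Set Classical

/-- **Monotonicity of the step-up successor function.**  Hypotheses are indexed by
the finite type `ι`, with p-values `p i : Ω → ℝ`.  For `ℛ ⊊ ℋ` the ordered
critical values `a n ℛ` (for `1 ≤ n ≤ |ℋ \ ℛ|`) lie in `[0,1]` and satisfy
`a n 𝒮 ≥ a n ℛ` whenever `ℛ ⊆ 𝒮 ⊊ ℋ` and `1 ≤ n ≤ |ℋ \ 𝒮|`.  Then the step-up
successor function
`N(ℛ) = ⋃ {𝒦 ⊆ ℋ \ ℛ : p i ≤ a (|ℋ \ (ℛ ∪ 𝒦)| + 1) ℛ for all i ∈ 𝒦}`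
satisfies, pointwise in ω, `N(ℛ) ⊆ N(𝒮) ∪ 𝒮` for every `ℛ ⊆ 𝒮 ⊊ ℋ`. -/
theorem stepup_successor_monotone
    {Ω : Type*} {ι : Type*} [Fintype ι]
    (p : ι → Ω → ℝ) (hprange : ∀ i ω, p i ω ∈ Set.Icc (0 : ℝ) 1)
    (a : ℕ → Set ι → ℝ)
    (harange : ∀ (R : Set ι) (n : ℕ), R ≠ Set.univ → 1 ≤ n → n ≤ Set.ncard Rᶜ →
      a n R ∈ Set.Icc (0 : ℝ) 1)
    (hordered : ∀ (R : Set ι) (n m : ℕ), R ≠ Set.univ →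
      1 ≤ n → n ≤ m → m ≤ Set.ncard Rᶜ → a m R ≤ a n R)
    (hamono : ∀ R S : Set ι, R ⊆ S → S ≠ Set.univ →
      ∀ n : ℕ, 1 ≤ n → n ≤ Set.ncard Sᶜ → a n R ≤ a n S)
    (N : Set ι → Ω → Set ι)
    (hN : ∀ R ω, N R ω = ⋃₀ {K : Set ι | K ⊆ Rᶜ ∧
      ∀ i ∈ K, p i ω ≤ a (Set.ncard (R ∪ K)ᶜ + 1) R}) :
    ∀ (ω : Ω) (R S : Set ι), R ⊆ S → S ≠ Set.univ → N R ω ⊆ N S ω ∪ S := by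
  intro ω R S hRS hS i hi
  have hR : R ≠ Set.univ := fun h => hS (Set.univ_subset_iff.1 (h ▸ hRS))
  by_cases hiS : i ∈ S
  · exact Or.inr hiS
  left
  rw [hN] at hi ⊢
  obtain ⟨K, ⟨hKR, hK⟩, hiK⟩ := hi
  refine ⟨K \ S, ⟨fun j hj => hj.2, fun j hj => ?_⟩, hiK, hiS⟩
  rw [Set.union_sdiff_self]
  have hle : Set.ncard (S ∪ K)ᶜ ≤ Set.ncard (R ∪ K)ᶜ :=
    Set.ncard_le_ncard (Set.compl_subset_compl.2 (Set.union_subset_union_left K hRS))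
      (Set.toFinite _)
  have hltS : Set.ncard (S ∪ K)ᶜ < Set.ncard Sᶜ :=
    Set.ncard_lt_ncard (Set.ssubset_iff_exists.2
      ⟨Set.compl_subset_compl.2 Set.subset_union_left, j, hj.2,
        fun h => h (Or.inr hj.1)⟩) (Set.toFinite _)
  have hltR : Set.ncard (R ∪ K)ᶜ < Set.ncard Rᶜ :=
    Set.ncard_lt_ncard (Set.ssubset_iff_exists.2
      ⟨Set.compl_subset_compl.2 Set.subset_union_left, j, hKR hj.1,
        fun h => h (Or.inr hj.1)⟩) (Set.toFinite _)
  calc p j ω ≤ a (Set.ncard (R ∪ K)ᶜ + 1) R := hK j hj.1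
    _ ≤ a (Set.ncard (S ∪ K)ᶜ + 1) R :=
      hordered R _ _ hR (Nat.le_add_left _ _) (Nat.succ_le_succ hle) hltR
    _ ≤ a (Set.ncard (S ∪ K)ᶜ + 1) S :=
      hamono R S hRS hS _ (Nat.le_add_left _ _) hltS
end
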